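/- arXiv:1904.01570 — 10 statements merged into one kernel-verified Lean document; each statement's English description precedes it below -/
import Mathlib

section
/- A finite digraph G is an oriented co-graph if and only if G contains no induced subdigraph isomorphic to the bidirected edge ↔P2, no induced subdigraph isomorphic to the oriented path →P3 (vertices a,b,c with exactly the arcs (a,b) and (b,c)), no induced subdigraph isomorphic to the directed cycle →C3 (vertices a,b,c with exactly the arcs (a,b), (b,c), (c,a)), and the underlying undirected graph un(G) contains no induced path P4 on four vertices. -/
/-- An oriented `k`-coloring of the digraph with arc relation `A`. -/
def IsOrientedColoring {V : Type} (A : V → V → Prop) (k : ℕ) (c : V → Fin k) : Prop :=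
  (∀ u v : V, A u v → c u ≠ c v) ∧
  ∀ u v x y : V, A u v → A x y → c v = c x → c u ≠ c y

/-- The oriented chromatic number: the least `k` admitting an oriented `k`-coloring. -/
noncomputable def orientedChromaticNumber {V : Type} (A : V → V → Prop) : ℕ :=
  sInf {k : ℕ | ∃ c : V → Fin k, IsOrientedColoring A k c}

/-- `IsOCOn A S`: the induced subdigraph of `A` on the vertex set `S` is an
oriented co-graph, i.e. it can be built from single vertices by disjoint
union and order composition. -/
inductive IsOCOn {V : Type} (A : V → V → Prop) : Set V → Prop
  | single (v : V) : IsOCOn A {v}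
  | union (S T : Set V) (hd : Disjoint S T) (hS : IsOCOn A S) (hT : IsOCOn A T)
      (harc : ∀ u ∈ S, ∀ v ∈ T, ¬ A u v ∧ ¬ A v u) : IsOCOn A (S ∪ T)
  | order (S T : Set V) (hd : Disjoint S T) (hS : IsOCOn A S) (hT : IsOCOn A T)
      (harc : ∀ u ∈ S, ∀ v ∈ T, A u v ∧ ¬ A v u) : IsOCOn A (S ∪ T)

/-- A digraph (on its whole vertex set) is an oriented co-graph. -/
def IsOrientedCograph {V : Type} (A : V → V → Prop) : Prop :=
  IsOCOn A Set.univ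

/-- Homomorphism of digraphs. -/
def IsDiHom {V W : Type} (A : V → V → Prop) (B : W → W → Prop) (f : V → W) : Prop :=
  ∀ u v : V, A u v → B (f u) (f v)

/-- Arc relation of the transitive tournament on `k` vertices. -/
def ttArcs (k : ℕ) : Fin k → Fin k → Prop := fun i j => i < j

/-- Arc relation of the oriented path on `n` vertices. -/
def pathArcs (n : ℕ) : Fin n → Fin n → Prop := fun i j => (i : ℕ) + 1 = (j : ℕ)

/-- Binary disjoint union of digraphs. -/
def dUnion {V W : Type} (A : V → V → Prop) (B : W → W → Prop) :
    V ⊕ W → V ⊕ W → Prop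
  | Sum.inl u, Sum.inl v => A u v
  | Sum.inr u, Sum.inr v => B u v
  | _, _ => False

/-- Binary order composition of digraphs. -/
def oComp {V W : Type} (A : V → V → Prop) (B : W → W → Prop) :
    V ⊕ W → V ⊕ W → Prop
  | Sum.inl u, Sum.inl v => A u v
  | Sum.inr u, Sum.inr v => B u v
  | Sum.inl _, Sum.inr _ => True
  | Sum.inr _, Sum.inl _ => False

/-- Disjoint union of a family of digraphs. -/
def dUnionK {k : ℕ} {V : Fin k → Type} (A : ∀ i, V i → V i → Prop) :
    (Σ i, V i) → (Σ i, V i) → Prop :=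
  fun u v => ∃ h : u.1 = v.1, A v.1 (h ▸ u.2) v.2

/-- Order composition of a family of digraphs: all arcs within the parts,
plus all arcs from part `i` to part `j` whenever `i < j`. -/
def oCompK {k : ℕ} {V : Fin k → Type} (A : ∀ i, V i → V i → Prop) :
    (Σ i, V i) → (Σ i, V i) → Prop :=
  fun u v => (∃ h : u.1 = v.1, A v.1 (h ▸ u.2) v.2) ∨ u.1 < v.1

/-- The length (number of arcs) of a longest oriented path: the largest `n`
such that there are `n+1` pairwise distinct vertices consecutively joined by arcs. -/
noncomputable def longestOrientedPath {V : Type} (A : V → V → Prop) : ℕ :=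
  sSup {n : ℕ | ∃ l : List V, l.Chain' A ∧ l.Nodup ∧ l.length = n + 1}

/-- No induced subdigraph isomorphic to the bidirected edge. -/
def NoBidirP2 {V : Type} (A : V → V → Prop) : Prop :=
  ∀ u v : V, u ≠ v → ¬ (A u v ∧ A v u)

/-- No induced subdigraph isomorphic to the oriented path on three vertices. -/
def NoInducedP3 {V : Type} (A : V → V → Prop) : Prop :=
  ¬ ∃ a b c : V, a ≠ b ∧ a ≠ c ∧ b ≠ c ∧ A a b ∧ A b c ∧
      ¬ A b a ∧ ¬ A c b ∧ ¬ A a c ∧ ¬ A c a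

/-- No induced subdigraph isomorphic to the directed cycle on three vertices. -/
def NoInducedC3 {V : Type} (A : V → V → Prop) : Prop :=
  ¬ ∃ a b c : V, a ≠ b ∧ a ≠ c ∧ b ≠ c ∧ A a b ∧ A b c ∧ A c a ∧
      ¬ A b a ∧ ¬ A c b ∧ ¬ A a c

/-- The underlying undirected graph of a digraph contains no induced path
on four vertices. -/
def UnP4Free {V : Type} (A : V → V → Prop) : Prop :=
  ¬ ∃ a b c d : V, a ≠ b ∧ a ≠ c ∧ a ≠ d ∧ b ≠ c ∧ b ≠ d ∧ c ≠ d ∧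
      (A a b ∨ A b a) ∧ (A b c ∨ A c b) ∧ (A c d ∨ A d c) ∧
      ¬ (A a c ∨ A c a) ∧ ¬ (A a d ∨ A d a) ∧ ¬ (A b d ∨ A d b)

/-- Forward direction: the order-theoretic properties hold on any co-graph part. -/
lemma oc_props {V : Type} (A : V → V → Prop) (hirr : ∀ v, ¬ A v v) (S : Set V)
    (h : IsOCOn A S) :
    (∀ a ∈ S, ∀ b ∈ S, A a b → ¬ A b a) ∧
    (∀ a ∈ S, ∀ b ∈ S, ∀ c ∈ S, A a b → A b c → A a c) ∧
    (∀ a ∈ S, ∀ b ∈ S, ∀ c ∈ S, ∀ d ∈ S,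
      (A a b ∨ A b a) → (A b c ∨ A c b) → (A c d ∨ A d c) →
      ¬ (A a c ∨ A c a) → ¬ (A a d ∨ A d a) → ¬ (A b d ∨ A d b) →
      a ≠ c → a ≠ d → b ≠ d → False) := by
  induction h with
  | single v =>
    refine ⟨?_, ?_, ?_⟩
    · rintro a rfl b rfl h; exact hirr _
    · rintro a rfl b rfl c rfl h; exact fun _ => h
    · rintro a rfl b rfl c rfl d rfl h; exact fun _ _ _ _ _ h _ _ => h rfl
  | union S T hd hS hT harc ihS ihT =>
    obtain ⟨s1, s2, s3⟩ := ihS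
    obtain ⟨t1, t2, t3⟩ := ihT
    refine ⟨?_, ?_, ?_⟩
    · rintro a (ha | ha) b (hb | hb) <;> grind
    · rintro a (ha | ha) b (hb | hb) c (hc | hc) <;> grind
    · rintro a (ha | ha) b (hb | hb) c (hc | hc) d (hd | hd) <;> grind
  | order S T hd hS hT harc ihS ihT =>
    obtain ⟨s1, s2, s3⟩ := ihS
    obtain ⟨t1, t2, t3⟩ := ihT
    refine ⟨?_, ?_, ?_⟩
    · rintro a (ha | ha) b (hb | hb) <;> grind
    · rintro a (ha | ha) b (hb | hb) c (hc | hc) <;> grind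
    · rintro a (ha | ha) b (hb | hb) c (hc | hc) d (hd | hd) <;> grind

/-- A finite `N`-free strict order with at least two elements decomposes. -/
lemma oc_split {V : Type} [Finite V] (A : V → V → Prop) (hirr : ∀ v, ¬ A v v)
    (htr : ∀ a b c, A a b → A b c → A a c)
    (hN : ∀ a b c d, A b a → A b c → A d c → ¬ A b d → ¬ A d b → ¬ A a c → ¬ A c a →
      ¬ A a d → ¬ A d a → a ≠ c → b ≠ d → a ≠ d → False)
    (S : Set V) (hS : S.Nontrivial) :
    ∃ X Y : Set V, X.Nonempty ∧ Y.Nonempty ∧ Disjoint X Y ∧ X ∪ Y = S ∧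
      ((∀ x ∈ X, ∀ y ∈ Y, ¬ A x y ∧ ¬ A y x) ∨ (∀ x ∈ X, ∀ y ∈ Y, A x y)) := by
  -- it suffices to give `X`
  suffices h : ∃ X ⊆ S, X.Nonempty ∧ (S \ X).Nonempty ∧
      ((∀ x ∈ X, ∀ y ∈ S \ X, ¬ A x y ∧ ¬ A y x) ∨ (∀ x ∈ X, ∀ y ∈ S \ X, A x y)) by
    obtain ⟨X, hX, h1, h2, h3⟩ := h
    exact ⟨X, S \ X, h1, h2, Set.disjoint_sdiff_right, Set.union_diff_cancel hX, h3⟩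
  -- a maximal element
  obtain ⟨v, hvS, hv⟩ : ∃ v ∈ S, ∀ x ∈ S, ¬ A v x := by
    haveI : IsTrans V (Function.swap A) := ⟨fun a b c h1 h2 => htr _ _ _ h2 h1⟩
    haveI : Std.Irrefl (Function.swap A) := ⟨fun a h => hirr a h⟩
    have wf := Finite.wellFounded_of_trans_of_irrefl (Function.swap A)
    obtain ⟨v, h1, h2⟩ := wf.has_min S hS.nonempty
    exact ⟨v, h1, fun x hx h => h2 x hx h⟩
  obtain ⟨w, hwS, hwv⟩ := hS.exists_ne v
  by_cases hU : ∀ u ∈ S, u ≠ v → A u v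
  · refine ⟨S \ {v}, Set.diff_subset, ⟨w, hwS, hwv⟩, ⟨v, hvS, by simp⟩, Or.inr ?_⟩
    rintro x ⟨hx, hxv⟩ y ⟨hy, hyv⟩
    have : y = v := by by_contra h; exact hyv ⟨hy, h⟩
    subst this
    exact hU x hx hxv
  push Not at hU
  obtain ⟨u0, hu0S, hu0v, hu0⟩ := hU
  -- first consequence of `N`-freeness
  have k1 : ∀ u ∈ S, u ≠ v → ¬ A u v → ∀ b ∈ S, b ≠ v → ¬ A b v → A b u →
      ∀ a ∈ S, A a v → A a u → A a b := by
    intro u hu huv hu' b hb hbv hb' hbu a ha hav hau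
    by_contra hab
    exact hN v a u b hav hau hbu hab (fun h => hb' (htr _ _ _ h hav)) (hv u hu) hu'
      (hv b hb) hb' huv.symm (by rintro rfl; exact hb' hav) hbv.symm
  -- second consequence
  have k2 : ∀ u ∈ S, u ≠ v → ¬ A u v → ∀ a ∈ S, A a v → A a u →
      ∀ d ∈ S, A d v → ¬ A d u → A a d := by
    intro u hu huv hu' a ha hav hau d hd hdv hdu
    by_contra had
    refine hN u a v d hau hav hdv had (fun h => hdu (htr _ _ _ h hau)) hu' (hv u hu)
      (fun h => hu' (htr _ _ _ h hdv)) hdu huv (by rintro rfl; exact hdu hau)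
      (by rintro rfl; exact hu' hdv)
  by_cases hE : ∃ u ∈ S, u ≠ v ∧ ¬ A u v ∧ ∀ a ∈ S, A a v → ¬ A a u
  · -- parallel decomposition
    obtain ⟨u, h1, h2, h3, h4⟩ := hE
    refine ⟨{u | u ∈ S ∧ u ≠ v ∧ ¬ A u v ∧ ∀ a ∈ S, A a v → ¬ A a u}, fun x hx => hx.1,
      ⟨u, h1, h2, h3, h4⟩, ⟨v, hvS, fun h => h.2.1 rfl⟩, Or.inl ?_⟩
    rintro x ⟨hx1, hx2, hx3, hx4⟩ y ⟨hy, hy'⟩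
    by_cases hyv : y = v
    · subst hyv
      exact ⟨hx3, hv x hx1⟩
    by_cases hyD : A y v
    · exact ⟨fun h => hx3 (htr _ _ _ h hyD), hx4 y hy hyD⟩
    refine ⟨fun h => hy' ⟨hy, hyv, hyD, fun a ha hav hay => ?_⟩,
      fun h => hy' ⟨hy, hyv, hyD, fun a ha hav hay => ?_⟩⟩
    · exact hx4 a ha hav (k1 y hy hyv hyD x hx1 hx2 hx3 h a ha hav hay)
    · exact hx4 a ha hav (htr _ _ _ hay h)
  · -- series decomposition
    push Not at hE
    obtain ⟨u, ⟨hu1, hu2, hu3⟩, hmin⟩ := Set.exists_min_image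
      {u | u ∈ S ∧ u ≠ v ∧ ¬ A u v} (fun u => {a | a ∈ S ∧ A a v ∧ A a u}.ncard)
      (Set.toFinite _) ⟨u0, hu0S, hu0v, hu0⟩
    refine ⟨{a | a ∈ S ∧ A a v ∧ A a u}, fun x hx => hx.1, hE u hu1 hu2 hu3,
      ⟨v, hvS, fun h => hirr v h.2.1⟩, Or.inr ?_⟩
    rintro x ⟨hx1, hx2, hx3⟩ y ⟨hy, hy'⟩
    by_cases hyv : y = v
    · subst hyv
      exact hx2
    by_cases hyD : A y v
    · exact k2 u hu1 hu2 hu3 x hx1 hx2 hx3 y hy hyD (fun h => hy' ⟨hy, hyD, h⟩)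
    by_contra hxy
    have hle := hmin y ⟨hy, hyv, hyD⟩
    have hlt : {a | a ∈ S ∧ A a v ∧ A a y}.ncard < {a | a ∈ S ∧ A a v ∧ A a u}.ncard := by
      apply Set.ncard_lt_ncard _ (Set.toFinite _)
      refine ⟨fun a ha => ⟨ha.1, ha.2.1, htr _ x _ ?_ hx3⟩, fun h => hxy (h ⟨hx1, hx2, hx3⟩).2.2⟩
      exact k2 y hy hyv hyD a ha.1 ha.2.1 ha.2.2 x hx1 hx2 hxy
    exact absurd hle (not_le.2 hlt)

/-- Backward direction. -/
lemma oc_build {V : Type} [Finite V] (A : V → V → Prop) (hirr : ∀ v, ¬ A v v)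
    (htr : ∀ a b c, A a b → A b c → A a c)
    (hN : ∀ a b c d, A b a → A b c → A d c → ¬ A b d → ¬ A d b → ¬ A a c → ¬ A c a →
      ¬ A a d → ¬ A d a → a ≠ c → b ≠ d → a ≠ d → False) :
    ∀ (n : ℕ) (S : Set V), S.ncard = n → S.Nonempty → IsOCOn A S := by
  intro n
  induction n using Nat.strong_induction_on with
  | _ n ih =>
    intro S hn hne
    rcases hne.exists_eq_singleton_or_nontrivial with ⟨v, rfl⟩ | hS
    · exact IsOCOn.single v
    obtain ⟨X, Y, hX, hY, hd, rfl, h⟩ := oc_split A hirr htr hN S hS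
    have hc := Set.ncard_union_eq hd (Set.toFinite X) (Set.toFinite Y)
    have hX' := (Set.ncard_pos (Set.toFinite X)).2 hX
    have hY' := (Set.ncard_pos (Set.toFinite Y)).2 hY
    have iX := ih X.ncard (by omega) X rfl hX
    have iY := ih Y.ncard (by omega) Y rfl hY
    rcases h with h | h
    · exact IsOCOn.union X Y hd iX iY h
    · exact IsOCOn.order X Y hd iX iY
        (fun x hx y hy => ⟨h x hx y hy, fun h' => hirr _ (htr _ _ _ (h x hx y hy) h')⟩)

/-- A finite digraph is an oriented co-graph iff it contains no
induced bidirected edge, no induced oriented `P3`, no induced directed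
triangle, and its underlying undirected graph is `P4`-free. -/
theorem stmt_1 {V : Type} [Fintype V] [Nonempty V] (A : V → V → Prop)
    (hirr : Irreflexive A) :
    IsOrientedCograph A ↔
      NoBidirP2 A ∧ NoInducedP3 A ∧ NoInducedC3 A ∧ UnP4Free A := by
  constructor
  · intro h
    obtain ⟨h1, h2, h3⟩ := oc_props A (fun v => hirr v) Set.univ h
    refine ⟨?_, ?_, ?_, ?_⟩
    · intro u v _ h
      exact h1 u trivial v trivial h.1 h.2
    · rintro ⟨a, b, c, -, -, -, hab, hbc, -, -, hac, -⟩
      exact hac (h2 a trivial b trivial c trivial hab hbc)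
    · rintro ⟨a, b, c, -, -, -, hab, hbc, -, -, -, hac⟩
      exact hac (h2 a trivial b trivial c trivial hab hbc)
    · rintro ⟨a, b, c, d, -, n1, n2, -, n3, -, e1, e2, e3, f1, f2, f3⟩
      exact h3 a trivial b trivial c trivial d trivial e1 e2 e3 f1 f2 f3 n1 n2 n3
  · rintro ⟨h1, h2, h3, h4⟩
    have hi : ∀ v, ¬ A v v := fun v => hirr v
    have has : ∀ a b, A a b → ¬ A b a := fun a b h h' =>
      h1 a b (by rintro rfl; exact hi _ h) ⟨h, h'⟩
    have hne : ∀ a b, A a b → a ≠ b := by rintro a b h rfl; exact hi _ h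
    have htr : ∀ a b c, A a b → A b c → A a c := by
      intro a b c hab hbc
      by_contra hac
      have hac' : a ≠ c := by rintro rfl; exact has _ _ hab hbc
      by_cases hca : A c a
      · exact h3 ⟨a, b, c, hne _ _ hab, hac', hne _ _ hbc, hab, hbc, hca,
          has _ _ hab, has _ _ hbc, hac⟩
      · exact h2 ⟨a, b, c, hne _ _ hab, hac', hne _ _ hbc, hab, hbc,
          has _ _ hab, has _ _ hbc, hac, hca⟩
    refine oc_build A hi htr ?_ _ Set.univ rfl Set.univ_nonempty
    intro a b c d e1 e2 e3 n1 n2 n3 n4 n5 n6 m1 m2 m3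
    exact h4 ⟨a, b, c, d, (hne _ _ e1).symm, m1, m3, hne _ _ e2, m2, (hne _ _ e3).symm,
      Or.inr e1, Or.inl e2, Or.inr e3, by tauto, by tauto, by tauto⟩
end

section
/- A finite digraph G is an oriented co-graph if and only if G is an oriented graph (no loops and no pair of opposite arcs), G is transitive, and the underlying undirected graph un(G) contains no induced path P4 on four vertices. -/
/-- The vertex set `S` splits as a disjoint union or as an order composition. -/
def OCSplit {V : Type} (A : V → V → Prop) (S : Finset V) : Prop :=
  ∃ P : V → Prop, (∃ a ∈ S, P a) ∧ (∃ b ∈ S, ¬ P b) ∧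
    ((∀ a ∈ S, ∀ b ∈ S, P a → ¬ P b → ¬ A a b ∧ ¬ A b a) ∨
     (∀ a ∈ S, ∀ b ∈ S, P a → ¬ P b → A a b))

set_option maxHeartbeats 4000000 in
theorem ocSplit_insert {V : Type} [DecidableEq V] (A : V → V → Prop)
    (hirr : ∀ a, ¬ A a a) (htr : ∀ u v w, A u v → A v w → A u w)
    (hP : ∀ a b c d : V, (A a b ∨ A b a) → (A b c ∨ A c b) → (A c d ∨ A d c) →
      ¬ (A a c ∨ A c a) → ¬ (A a d ∨ A d a) → ¬ (A b d ∨ A d b) → False)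
    (S : Finset V) (v : V) (hv : v ∉ S) (h : OCSplit A S) : OCSplit A (insert v S) := by
  have hne : ∀ a ∈ S, a ≠ v := fun a ha e => hv (e ▸ ha)
  obtain ⟨P, ⟨a, ha, hPa⟩, ⟨b, hb, hPb⟩, h | h⟩ := h
  · by_cases h1 : ∀ x ∈ S, P x → ¬ A x v ∧ ¬ A v x
    · refine ⟨fun x => x ≠ v ∧ P x, ⟨a, by simp [ha], hne a ha, hPa⟩, ⟨v, by simp, by simp⟩, .inl ?_⟩
      grind
    by_cases h2 : ∀ x ∈ S, ¬ P x → ¬ A x v ∧ ¬ A v x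
    · refine ⟨fun x => x ≠ v ∧ ¬ P x, ⟨b, by simp [hb], hne b hb, hPb⟩, ⟨v, by simp, by simp⟩, .inl ?_⟩
      grind
    have h1' : ∃ x ∈ S, P x ∧ (A x v ∨ A v x) := by grind
    have h2' : ∃ x ∈ S, ¬ P x ∧ (A x v ∨ A v x) := by grind
    clear h1 h2
    obtain ⟨x, hx, hPx, hxv⟩ := h1'
    obtain ⟨y, hy, hPy, hyv⟩ := h2'
    by_cases h3 : ∃ d ∈ S, ¬ A d v ∧ ¬ A v d
    · obtain ⟨d, hd, hdv⟩ := h3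
      refine ⟨fun z => z ≠ v ∧ ¬ A z v ∧ ¬ A v z, ⟨d, by simp [hd], hne d hd, hdv⟩,
        ⟨v, by simp, by simp⟩, .inl ?_⟩
      intro p hp q hq hp' hq'
      obtain ⟨hpv, hp1, hp2⟩ := hp'
      have hpS : p ∈ S := by grind
      by_cases hqv : q = v
      · subst hqv; exact ⟨hp1, hp2⟩
      have hqS : q ∈ S := by grind
      have hqa : A q v ∨ A v q := by grind
      by_contra hc
      have hpq : A p q ∨ A q p := by tauto
      by_cases hPp : P p
      · have hPq : P q := by
          by_contra hPq
          exact hc (h p hpS q hqS hPp hPq)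
        have k1 := h p hpS y hy hPp hPy
        have k2 := h q hqS y hy hPq hPy
        exact hP p q v y hpq hqa (by tauto) (by tauto) (by tauto) (by tauto)
      · have hPq : ¬ P q := by
          intro hPq
          exact hc (h q hqS p hpS hPq hPp).symm
        have k1 := h x hx p hpS hPx hPp
        have k2 := h x hx q hqS hPx hPq
        exact hP p q v x hpq hqa (by tauto) (by tauto) (by tauto) (by tauto)
    · have h3' : ∀ d ∈ S, A d v ∨ A v d := by grind
      clear h3
      rcases hxv with hxv | hxv
      · have hyv' : A y v := by grind
        have hall : ∀ d ∈ S, A d v := by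
          intro d hd
          by_cases hPd : P d <;> grind
        refine ⟨fun z => z ≠ v, ⟨x, by simp [hx], hne x hx⟩, ⟨v, by simp, by simp⟩, .inr ?_⟩
        grind
      · have hyv' : A v y := by grind
        have hall : ∀ d ∈ S, A v d := by
          intro d hd
          by_cases hPd : P d <;> grind
        refine ⟨fun z => z = v, ⟨v, by simp⟩, ⟨x, by simp [hx], hne x hx⟩, .inr ?_⟩
        grind
  · by_cases h1 : ∀ x ∈ S, P x → A x v
    · refine ⟨fun x => x ≠ v ∧ P x, ⟨a, by simp [ha], hne a ha, hPa⟩, ⟨v, by simp, by simp⟩, .inr ?_⟩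
      grind
    by_cases h2 : ∀ x ∈ S, ¬ P x → A v x
    · refine ⟨fun x => x = v ∨ P x, ⟨v, by simp⟩, ⟨b, by simp [hb], by simp [hne b hb, hPb]⟩, .inr ?_⟩
      grind
    have h1' : ∃ x ∈ S, P x ∧ ¬ A x v := by grind
    have h2' : ∃ x ∈ S, ¬ P x ∧ ¬ A v x := by grind
    clear h1 h2
    obtain ⟨x, hx, hPx, hxv⟩ := h1'
    obtain ⟨y, hy, hPy, hyv⟩ := h2'
    have h4 : ∀ z ∈ S, P z → ¬ A v z := fun z hz hPz hc => hyv (htr _ _ _ hc (h z hz y hy hPz hPy))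
    have h5 : ∀ z ∈ S, ¬ P z → ¬ A z v := fun z hz hPz hc => hxv (htr _ _ _ (h x hx z hz hPx hPz) hc)
    by_cases h6 : ∃ z ∈ S, A z v
    · obtain ⟨z, hz, hzv⟩ := h6
      refine ⟨fun z => z ≠ v ∧ A z v, ⟨z, by simp [hz], hne z hz, hzv⟩, ⟨v, by simp, by simp⟩, .inr ?_⟩
      intro p hp q hq hp' hq'
      obtain ⟨hpv, hp1⟩ := hp'
      have hpS : p ∈ S := by grind
      by_cases hqv : q = v
      · subst hqv; exact hp1
      have hqS : q ∈ S := by grind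
      have hqa : ¬ A q v := by grind
      have hPp : P p := by grind
      by_cases hPq : P q
      · by_contra hc
        have hqp : ¬ A q p := fun hh => hqa (htr _ _ _ hh hp1)
        exact hP v p y q (.inr hp1) (.inl (h p hpS y hy hPp hPy)) (.inr (h q hqS y hy hPq hPy))
          (by grind) (by grind) (by tauto)
      · exact h p hpS q hqS hPp hPq
    by_cases h7 : ∃ z ∈ S, A v z
    · obtain ⟨z, hz, hzv⟩ := h7
      refine ⟨fun z => ¬ A v z, ⟨v, by simp, hirr v⟩, ⟨z, by simp [hz], by simpa using hzv⟩, .inr ?_⟩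
      intro q hq p hp hqa hp'
      have hp1 : A v p := by simpa using hp'
      have hpS : p ∈ S := by grind
      by_cases hqv : q = v
      · subst hqv; exact hp1
      have hqS : q ∈ S := by grind
      have hPp : ¬ P p := by grind
      by_cases hPq : P q
      · exact h q hqS p hpS hPq hPp
      · by_contra hc
        have hqp : ¬ A p q := fun hh => hqa (htr _ _ _ hp1 hh)
        exact hP v p x q (.inl hp1) (.inr (h x hx p hpS hPx hPp)) (.inl (h x hx q hqS hPx hPq))
          (by grind) (by grind) (by tauto)
    · refine ⟨fun z => z = v, ⟨v, by simp⟩, ⟨x, by simp [hx], hne x hx⟩, .inl ?_⟩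
      grind

theorem ocSplit_of {V : Type} [DecidableEq V] (A : V → V → Prop)
    (hirr : ∀ a, ¬ A a a) (htr : ∀ u v w, A u v → A v w → A u w)
    (hP : ∀ a b c d : V, (A a b ∨ A b a) → (A b c ∨ A c b) → (A c d ∨ A d c) →
      ¬ (A a c ∨ A c a) → ¬ (A a d ∨ A d a) → ¬ (A b d ∨ A d b) → False)
    (S : Finset V) : 2 ≤ S.card → OCSplit A S := by
  induction S using Finset.induction_on with
  | empty => simp
  | insert v S hv ih =>
    intro hc
    rw [Finset.card_insert_of_notMem hv] at hc
    by_cases h2 : 2 ≤ S.card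
    · exact ocSplit_insert A hirr htr hP S v hv (ih h2)
    · obtain ⟨w, rfl⟩ := Finset.card_eq_one.1 (show S.card = 1 by omega)
      have hwv : w ≠ v := by rintro rfl; simp at hv
      by_cases h : A v w
      · refine ⟨fun z => z = v, ⟨v, by simp⟩, ⟨w, by simp, hwv⟩, .inr ?_⟩
        grind
      by_cases h' : A w v
      · refine ⟨fun z => z = w, ⟨w, by simp⟩, ⟨v, by simp, hwv.symm⟩, .inr ?_⟩
        grind
      · refine ⟨fun z => z = v, ⟨v, by simp⟩, ⟨w, by simp, hwv⟩, .inl ?_⟩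
        grind

theorem isOCOn_of {V : Type} [DecidableEq V] (A : V → V → Prop)
    (hirr : ∀ a, ¬ A a a) (htr : ∀ u v w, A u v → A v w → A u w)
    (hP : ∀ a b c d : V, (A a b ∨ A b a) → (A b c ∨ A c b) → (A c d ∨ A d c) →
      ¬ (A a c ∨ A c a) → ¬ (A a d ∨ A d a) → ¬ (A b d ∨ A d b) → False)
    (S : Finset V) : S.Nonempty → IsOCOn A (S : Set V) := by
  classical
  induction S using Finset.strongInduction with
  | H S ih =>
    intro hne
    by_cases h2 : 2 ≤ S.card
    · obtain ⟨P, ⟨a, ha, hPa⟩, ⟨b, hb, hPb⟩, h⟩ := ocSplit_of A hirr htr hP S h2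
      have e : (S : Set V) = ((S.filter P : Finset V) : Set V) ∪
          ((S.filter (fun x => ¬ P x) : Finset V) : Set V) := by
        ext x
        simp only [Finset.coe_filter, Set.mem_union, Set.mem_setOf_eq, Finset.mem_coe]
        tauto
      have hd : Disjoint ((S.filter P : Finset V) : Set V)
          (S.filter (fun x => ¬ P x) : Finset V) := by
        rw [Finset.disjoint_coe]; exact Finset.disjoint_filter_filter_not _ _ _
      have i1 := ih (S.filter P) (Finset.filter_ssubset.2 ⟨b, hb, hPb⟩)
        ⟨a, by simp [ha, hPa]⟩
      have i2 := ih (S.filter (fun x => ¬ P x)) (Finset.filter_ssubset.2 ⟨a, ha, by simpa using hPa⟩)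
        ⟨b, by simp [hb, hPb]⟩
      rw [e]
      rcases h with h | h
      · refine IsOCOn.union _ _ hd i1 i2 ?_
        intro u hu v hv
        simp only [Finset.coe_filter, Set.mem_setOf_eq] at hu hv
        exact h u hu.1 v hv.1 hu.2 hv.2
      · refine IsOCOn.order _ _ hd i1 i2 ?_
        intro u hu v hv
        simp only [Finset.coe_filter, Set.mem_setOf_eq] at hu hv
        have := h u hu.1 v hv.1 hu.2 hv.2
        exact ⟨this, fun hc => hirr _ (htr _ _ _ this hc)⟩
    · have := hne.card_pos
      obtain ⟨w, rfl⟩ := Finset.card_eq_one.1 (show S.card = 1 by omega)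
      rw [Finset.coe_singleton]
      exact IsOCOn.single w

set_option maxHeartbeats 4000000 in
theorem isOCOn_props {V : Type} (A : V → V → Prop) (hirr : ∀ a, ¬ A a a)
    (S : Set V) (h : IsOCOn A S) :
    (∀ u ∈ S, ∀ v ∈ S, A u v → ¬ A v u) ∧
    (∀ u ∈ S, ∀ v ∈ S, ∀ w ∈ S, A u v → A v w → A u w) ∧
    (∀ a ∈ S, ∀ b ∈ S, ∀ c ∈ S, ∀ d ∈ S,
      (A a b ∨ A b a) → (A b c ∨ A c b) → (A c d ∨ A d c) →
      ¬ (A a c ∨ A c a) → ¬ (A a d ∨ A d a) → ¬ (A b d ∨ A d b) → False) := by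
  induction h with
  | single v => simp [hirr]
  | union S T hd hS hT harc ihS ihT =>
    obtain ⟨s1, s2, s3⟩ := ihS
    obtain ⟨t1, t2, t3⟩ := ihT
    refine ⟨?_, ?_, ?_⟩
    · rintro u (hu | hu) v (hv | hv) <;> grind
    · rintro u (hu | hu) v (hv | hv) w (hw | hw) <;> grind
    · rintro a (ha | ha) b (hb | hb) c (hc | hc) d (hd | hd) h1 h2 h3 h4 h5 h6
      case inl.inl.inl.inl => exact s3 a ha b hb c hc d hd h1 h2 h3 h4 h5 h6
      case inr.inr.inr.inr => exact t3 a ha b hb c hc d hd h1 h2 h3 h4 h5 h6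
      all_goals clear s1 s2 s3 t1 t2 t3; grind
  | order S T hd hS hT harc ihS ihT =>
    obtain ⟨s1, s2, s3⟩ := ihS
    obtain ⟨t1, t2, t3⟩ := ihT
    refine ⟨?_, ?_, ?_⟩
    · rintro u (hu | hu) v (hv | hv) <;> grind
    · rintro u (hu | hu) v (hv | hv) w (hw | hw) <;> grind
    · rintro a (ha | ha) b (hb | hb) c (hc | hc) d (hd | hd) h1 h2 h3 h4 h5 h6
      case inl.inl.inl.inl => exact s3 a ha b hb c hc d hd h1 h2 h3 h4 h5 h6
      case inr.inr.inr.inr => exact t3 a ha b hb c hc d hd h1 h2 h3 h4 h5 h6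
      all_goals clear s1 s2 s3 t1 t2 t3; grind

/-- A finite digraph is an oriented co-graph iff it is an
oriented graph (no opposite arcs), transitive, and its underlying undirected
graph is `P4`-free. -/
theorem stmt_2 {V : Type} [Fintype V] [Nonempty V] (A : V → V → Prop)
    (hirr : Irreflexive A) :
    IsOrientedCograph A ↔
      (∀ u v : V, A u v → ¬ A v u) ∧
      (∀ u v w : V, A u v → A v w → u ≠ w → A u w) ∧
      UnP4Free A := by
  classical
  have hirr' : ∀ a, ¬ A a a := hirr
  constructor
  · intro h
    obtain ⟨h1, h2, h3⟩ := isOCOn_props A hirr' _ h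
    refine ⟨fun u v => h1 u trivial v trivial,
      fun u v w a b _ => h2 u trivial v trivial w trivial a b, ?_⟩
    rintro ⟨a, b, c, d, -, -, -, -, -, -, k1, k2, k3, k4, k5, k6⟩
    exact h3 a trivial b trivial c trivial d trivial k1 k2 k3 k4 k5 k6
  · rintro ⟨h1, h2, h3⟩
    have htr : ∀ u v w, A u v → A v w → A u w := by
      intro u v w a b
      by_cases e : u = w
      · subst e; exact absurd b (h1 _ _ a)
      · exact h2 u v w a b e
    have := isOCOn_of A hirr' htr (by
      intro a b c d k1 k2 k3 k4 k5 k6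
      refine h3 ⟨a, b, c, d, ?_, ?_, ?_, ?_, ?_, ?_, k1, k2, k3, k4, k5, k6⟩ <;>
        rintro rfl <;> grind) Finset.univ Finset.univ_nonempty
    rw [Finset.coe_univ] at this
    exact this
end

section
/- An undirected graph G is a co-graph (P4-free) if and only if there exists an orientation G' of G such that G' is an oriented co-graph. -/
def P4F {V : Type} (G : SimpleGraph V) : Prop :=
  ∀ a b c d : V, G.Adj a b → G.Adj b c → G.Adj c d →
    G.Adj a c ∨ G.Adj a d ∨ G.Adj b d ∨ a = c ∨ a = d ∨ b = d

theorem P4F.compl {V : Type} {G : SimpleGraph V} (h : P4F G) : P4F Gᶜ := by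
  intro a b c d hab hbc hcd
  simp only [SimpleGraph.compl_adj] at *
  by_contra hcon
  have h1 := h b d a c
  have e1 := G.adj_comm b d
  have e2 := G.adj_comm a d
  have e3 := G.adj_comm a b
  have e4 := G.adj_comm c d
  grind

/-- `S` splits into two nonempty parts without edges in between. -/
def GSplit {V : Type} (G : SimpleGraph V) (S : Set V) : Prop :=
  ∃ X Y : Set V, X.Nonempty ∧ Y.Nonempty ∧ Disjoint X Y ∧ X ∪ Y = S ∧
    ∀ u ∈ X, ∀ v ∈ Y, ¬ G.Adj u v

theorem sep_of {V : Type} {G : SimpleGraph V} {S X : Set V} (hX : X.Nonempty) (hXS : X ⊆ S)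
    {y : V} (hy : y ∈ S) (hyX : y ∉ X) (h : ∀ u ∈ X, ∀ v ∈ S, v ∉ X → ¬ G.Adj u v) : GSplit G S :=
  ⟨X, S \ X, hX, ⟨y, hy, hyX⟩, Set.disjoint_sdiff_right, Set.union_sdiff_cancel hXS,
    fun u hu v hv => h u hu v hv.1 hv.2⟩

theorem sep_aux {V : Type} {G : SimpleGraph V} (h : P4F G) {X Y : Set V} {v b : V}
    (hY : Y.Nonempty) (hd : Disjoint X Y) (hv : v ∉ X ∪ Y)
    (hn : ∀ x ∈ X, ∀ y ∈ Y, ¬ G.Adj x y) (hb : b ∈ X) (hbv : ¬ G.Adj v b) :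
    GSplit G (insert v (X ∪ Y)) := by
  rw [Set.disjoint_left] at hd
  simp only [Set.mem_union, not_or] at hv
  by_cases hdy : ∃ d ∈ Y, G.Adj v d
  · obtain ⟨d, hdY, hvd⟩ := hdy
    refine sep_of (X := {x | x ∈ X ∧ ¬ G.Adj v x}) ⟨b, hb, hbv⟩ ?_ (y := v) (by simp) ?_ ?_
    · intro x hx; simp [hx.1]
    · intro hh; exact hv.1 hh.1
    · rintro x ⟨hx, hvx⟩ w hw hwX hxw
      rcases hw with rfl | hw | hw
      · exact hvx hxw.symm
      · have hvw : G.Adj v w := by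
          by_contra hc; exact hwX ⟨hw, hc⟩
        rcases h x w v d hxw hvw.symm hvd with e | e | e | e | e | e
        · exact hvx e.symm
        · exact hn _ hx _ hdY e
        · exact hn _ hw _ hdY e
        · exact hv.1 (e ▸ hx)
        · exact hd hx (e ▸ hdY)
        · exact hd hw (e ▸ hdY)
      · exact hn _ hx _ hw hxw
  · push Not at hdy
    refine sep_of (X := Y) hY (fun y hy => by simp [hy]) (y := v) (by simp) hv.2 ?_
    rintro y hy w hw hwY hyw
    rcases hw with rfl | hw | hw
    · exact hdy y hy hyw.symm
    · exact hn _ hw _ hy hyw.symm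
    · exact hwY hw

theorem sep_insert {V : Type} {G : SimpleGraph V} (h : P4F G) {S : Set V} {v : V}
    (hv : v ∉ S) (hS : GSplit G S) : GSplit G (insert v S) ∨ GSplit Gᶜ (insert v S) := by
  obtain ⟨X, Y, hX, hY, hd, rfl, hn⟩ := hS
  by_cases hall : ∀ b ∈ X ∪ Y, G.Adj v b
  · right
    obtain ⟨x, hx⟩ := hX
    refine sep_of (X := {v}) (by simp) (by simp) (y := x) (by simp [hx]) ?_ ?_
    · rintro rfl; exact hv (Or.inl hx)
    · rintro u rfl w hw hwu
      rcases hw with rfl | hw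
      · exact absurd rfl hwu
      · have := hall w hw
        simp [SimpleGraph.compl_adj, this]
  · left
    push Not at hall
    obtain ⟨b, hb | hb, hvb⟩ := hall
    · exact sep_aux h hY hd hv hn hb hvb
    · rw [Set.union_comm]
      exact sep_aux h hX hd.symm (by rwa [Set.union_comm])
        (fun x hx y hy e => hn y hy x hx e.symm) hb hvb

theorem sep_main {V : Type} {G : SimpleGraph V} (h : P4F G) {S : Set V} (hf : S.Finite) :
    S.Subsingleton ∨ GSplit G S ∨ GSplit Gᶜ S := by
  induction S, hf using Set.Finite.induction_on with
  | empty => left; simp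
  | @insert v S hv hf ih =>
    rcases ih with hs | hs | hs
    · rcases S.eq_empty_or_nonempty with rfl | ⟨w, hw⟩
      · left; simp
      · right
        have hS : S = {w} := by
          ext x; exact ⟨fun hx => hs hx hw, fun hx => hx ▸ hw⟩
        subst hS
        have hvw : v ≠ w := hv
        have : Disjoint ({v} : Set V) {w} := by simpa using hvw
        by_cases e : G.Adj v w
        · right
          exact ⟨{v}, {w}, by simp, by simp, this, Set.singleton_union, by simp [e]⟩
        · left
          exact ⟨{v}, {w}, by simp, by simp, this, Set.singleton_union, by simp [e]⟩
    · exact Or.inr (sep_insert h hv hs)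
    · have := sep_insert h.compl hv hs
      rw [compl_compl] at this
      exact Or.inr this.symm

theorem IsOCOn.congr' {V : Type} {A B : V → V → Prop} {S : Set V} (h : IsOCOn A S)
    (hAB : ∀ u ∈ S, ∀ v ∈ S, (A u v ↔ B u v)) : IsOCOn B S := by
  induction h with
  | single v => exact .single v
  | union S T hd hS hT harc ih1 ih2 =>
    refine .union S T hd (ih1 fun u hu v hv => hAB u (.inl hu) v (.inl hv))
      (ih2 fun u hu v hv => hAB u (.inr hu) v (.inr hv)) fun u hu v hv => ?_
    rw [← hAB u (.inl hu) v (.inr hv), ← hAB v (.inr hv) u (.inl hu)]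
    exact harc u hu v hv
  | order S T hd hS hT harc ih1 ih2 =>
    refine .order S T hd (ih1 fun u hu v hv => hAB u (.inl hu) v (.inl hv))
      (ih2 fun u hu v hv => hAB u (.inr hu) v (.inr hv)) fun u hu v hv => ?_
    rw [← hAB u (.inl hu) v (.inr hv), ← hAB v (.inr hv) u (.inl hu)]
    exact harc u hu v hv

theorem exists_orient {V : Type} [Fintype V] {G : SimpleGraph V} (h : P4F G) (n : ℕ) :
    ∀ S : Set V, S.ncard = n → S.Nonempty → ∃ A : V → V → Prop,
      (∀ u v : V, A u v → G.Adj u v) ∧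
      (∀ u ∈ S, ∀ v ∈ S, G.Adj u v → (A u v ∨ A v u)) ∧
      (∀ u v : V, ¬ (A u v ∧ A v u)) ∧ IsOCOn A S := by
  induction n using Nat.strong_induction_on with
  | _ n ih =>
  intro S hn hne
  have key : ∀ X Y : Set V, X.Nonempty → Y.Nonempty → Disjoint X Y → X ∪ Y = S →
      ∃ A : V → V → Prop, (∀ u v : V, A u v → G.Adj u v) ∧
      (∀ u ∈ S, ∀ v ∈ S, G.Adj u v → (A u v ∨ A v u)) ∧
      (∀ u v : V, ¬ (A u v ∧ A v u)) ∧ IsOCOn A X ∧ IsOCOn A Y ∧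
      ∀ u ∈ X, ∀ v ∈ Y, (A u v ↔ G.Adj u v) ∧ ¬ A v u := by
    rintro X Y hX hY hd rfl
    have hc := Set.ncard_union_eq hd (Set.toFinite _) (Set.toFinite _)
    have hX0 := (Set.ncard_pos (Set.toFinite _)).2 hX
    have hY0 := (Set.ncard_pos (Set.toFinite _)).2 hY
    obtain ⟨A, a1, a2, a3, a4⟩ := ih X.ncard (by omega) X rfl hX
    obtain ⟨B, b1, b2, b3, b4⟩ := ih Y.ncard (by omega) Y rfl hY
    rw [Set.disjoint_left] at hd
    refine ⟨fun u v => (u ∈ X ∧ v ∈ X ∧ A u v) ∨ (u ∈ Y ∧ v ∈ Y ∧ B u v) ∨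
      (u ∈ X ∧ v ∈ Y ∧ G.Adj u v), ?_, ?_, ?_, ?_, ?_, ?_⟩
    · grind
    · intro u hu v hv e
      have := e.symm
      rcases hu with hu | hu <;> rcases hv with hv | hv <;> grind
    · grind
    · exact a4.congr' (by grind)
    · exact b4.congr' (by grind)
    · grind
  rcases sep_main h (Set.toFinite S) with hs | hs | hs
  · obtain ⟨w, hw⟩ := hne
    have hS : S = {w} := by
      ext x; exact ⟨fun hx => hs hx hw, fun hx => hx ▸ hw⟩
    subst hS
    refine ⟨fun _ _ => False, by simp, ?_, by simp, .single w⟩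
    rintro u rfl v rfl e
    exact absurd e (G.irrefl)
  · obtain ⟨X, Y, hX, hY, hd, hS, hn⟩ := hs
    obtain ⟨A, a1, a2, a3, a4, a5, a6⟩ := key X Y hX hY hd hS
    refine ⟨A, a1, a2, a3, hS ▸ .union X Y hd a4 a5 ?_⟩
    exact fun u hu v hv => ⟨fun e => hn u hu v hv (a1 _ _ e), (a6 u hu v hv).2⟩
  · obtain ⟨X, Y, hX, hY, hd, hS, hn⟩ := hs
    obtain ⟨A, a1, a2, a3, a4, a5, a6⟩ := key X Y hX hY hd hS
    refine ⟨A, a1, a2, a3, hS ▸ .order X Y hd a4 a5 ?_⟩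
    refine fun u hu v hv => ⟨(a6 u hu v hv).1.2 ?_, (a6 u hu v hv).2⟩
    have h1 := hn u hu v hv
    have h2 : u ≠ v := fun e => Set.disjoint_left.1 hd hu (e ▸ hv)
    rw [SimpleGraph.compl_adj] at h1
    by_contra h3
    exact h1 ⟨h2, h3⟩

theorem IsOCOn.noP4 {V : Type} {A : V → V → Prop} {G : SimpleGraph V} {S : Set V}
    (h : IsOCOn A S) (hA : ∀ u v, G.Adj u v ↔ (A u v ∨ A v u)) :
    ∀ a ∈ S, ∀ b ∈ S, ∀ c ∈ S, ∀ d ∈ S, G.Adj a b → G.Adj b c → G.Adj c d →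
      ¬ G.Adj a c → ¬ G.Adj a d → ¬ G.Adj b d → a ≠ c → a ≠ d → b ≠ d → False := by
  induction h with
  | single v =>
    rintro a rfl b rfl c rfl d rfl
    simp
  | union S T hd hS hT harc ih1 ih2 =>
    have h1 : ∀ u ∈ S, ∀ v ∈ T, ¬ G.Adj u v := by grind
    have h2 : ∀ u ∈ S, ∀ v ∈ T, ¬ G.Adj v u := by grind
    clear harc hA hS hT hd
    rintro a (ha | ha) b (hb | hb) c (hc | hc) d (hd | hd) <;> grind
  | order S T hd hS hT harc ih1 ih2 =>
    have h1 : ∀ u ∈ S, ∀ v ∈ T, G.Adj u v := by grind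
    have h2 : ∀ u ∈ S, ∀ v ∈ T, G.Adj v u := by grind
    clear harc hA hS hT hd
    rintro a (ha | ha) b (hb | hb) c (hc | hc) d (hd | hd) <;> grind

/-- An undirected graph is a co-graph (`P4`-free) iff it has an
orientation which is an oriented co-graph. -/
theorem stmt_4 {V : Type} [Fintype V] [Nonempty V] (G : SimpleGraph V) :
    (¬ ∃ a b c d : V, a ≠ b ∧ a ≠ c ∧ a ≠ d ∧ b ≠ c ∧ b ≠ d ∧ c ≠ d ∧
        G.Adj a b ∧ G.Adj b c ∧ G.Adj c d ∧
        ¬ G.Adj a c ∧ ¬ G.Adj a d ∧ ¬ G.Adj b d) ↔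
      ∃ A : V → V → Prop,
        (∀ u v : V, A u v → G.Adj u v) ∧
        (∀ u v : V, G.Adj u v → (A u v ∨ A v u)) ∧
        (∀ u v : V, ¬ (A u v ∧ A v u)) ∧
        IsOrientedCograph A := by
  constructor
  · intro h
    have hP : P4F G := by
      intro a b c d h1 h2 h3
      by_contra hc
      push Not at hc
      exact h ⟨a, b, c, d, h1.ne, hc.2.2.2.1, hc.2.2.2.2.1, h2.ne, hc.2.2.2.2.2, h3.ne,
        h1, h2, h3, hc.1, hc.2.1, hc.2.2.1⟩
    obtain ⟨A, a1, a2, a3, a4⟩ := exists_orient hP _ Set.univ rfl Set.univ_nonempty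
    exact ⟨A, a1, fun u v => a2 u trivial v trivial, a3, a4⟩
  · rintro ⟨A, a1, a2, a3, a4⟩ ⟨a, b, c, d, -, n1, n2, -, n3, -, h1, h2, h3, h4, h5, h6⟩
    exact IsOCOn.noP4 (G := G) a4
      (fun u v => ⟨a2 u v, fun e => e.elim (a1 u v) fun e => (a1 v u e).symm⟩)
      a trivial b trivial c trivial d trivial h1 h2 h3 h4 h5 h6 n1 n2 n3
end

section
/- Let G1,…,Gk be k vertex-disjoint finite nonempty oriented graphs. Then χ_o(G1 ⊘ … ⊘ Gk) = χ_o(G1) + … + χ_o(Gk). -/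
theorem ocn_le_card {V C : Type} [Fintype C] (A : V → V → Prop) (c : V → C)
    (h1 : ∀ u v : V, A u v → c u ≠ c v)
    (h2 : ∀ u v x y : V, A u v → A x y → c v = c x → c u ≠ c y) :
    orientedChromaticNumber A ≤ Fintype.card C := by
  refine Nat.sInf_le ⟨fun v => Fintype.equivFin C (c v), ?_, ?_⟩
  · intro u v h e
    exact h1 u v h ((Fintype.equivFin C).injective e)
  · intro u v x y h h' e e'
    exact h2 u v x y h h' ((Fintype.equivFin C).injective e) ((Fintype.equivFin C).injective e')

theorem ocn_attained {V : Type} [Fintype V] (A : V → V → Prop)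
    (hirr : Irreflexive A) (hor : ∀ u v, A u v → ¬ A v u) :
    ∃ c : V → Fin (orientedChromaticNumber A),
      IsOrientedColoring A (orientedChromaticNumber A) c := by
  have hne : {k : ℕ | ∃ c : V → Fin k, IsOrientedColoring A k c}.Nonempty := by
    refine ⟨Fintype.card V, Fintype.equivFin V, ?_, ?_⟩
    · intro u v h e
      have := (Fintype.equivFin V).injective e
      subst this
      exact (hor _ _ h) h
    · intro u v x y h h' e e'
      have := (Fintype.equivFin V).injective e
      have := (Fintype.equivFin V).injective e'
      subst_vars
      exact hor _ _ h h'
  exact Nat.sInf_mem hne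

theorem oCompK_same {k : ℕ} {V : Fin k → Type} (A : ∀ i, V i → V i → Prop) (i : Fin k)
    (u v : V i) : oCompK A ⟨i, u⟩ ⟨i, v⟩ ↔ A i u v := by
  simp [oCompK]

theorem oCompK_le {k : ℕ} {V : Fin k → Type} (A : ∀ i, V i → V i → Prop)
    (u v : Σ i, V i) (h : oCompK A u v) : u.1 ≤ v.1 := by
  rcases h with ⟨h, -⟩ | h
  · exact h.le
  · exact h.le

/-- The oriented chromatic number of the order composition of
finitely many finite nonempty oriented graphs is the sum of the oriented
chromatic numbers of the parts. -/
theorem stmt_8 {k : ℕ} {V : Fin k → Type} [∀ i, Fintype (V i)]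
    [∀ i, Nonempty (V i)]
    (A : ∀ i, V i → V i → Prop)
    (hirr : ∀ i, Irreflexive (A i))
    (hor : ∀ i, ∀ u v : V i, A i u v → ¬ A i v u) :
    orientedChromaticNumber (oCompK A) =
      ∑ i, orientedChromaticNumber (A i) := by
  apply le_antisymm
  · choose c hc using fun i => ocn_attained (A i) (hirr i) (hor i)
    have key := ocn_le_card (C := Σ i, Fin (orientedChromaticNumber (A i))) (oCompK A)
      (fun u => ⟨u.1, c u.1 u.2⟩) ?_ ?_
    · simpa using key
    · rintro ⟨i, u⟩ ⟨j, v⟩ h e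
      obtain ⟨rfl, e⟩ := Sigma.mk.inj e
      rw [oCompK_same] at h
      exact (hc i).1 u v h (eq_of_heq e)
    · rintro ⟨i, u⟩ ⟨j, v⟩ ⟨i', x⟩ ⟨j', y⟩ h h' e e'
      obtain ⟨h1, e⟩ := Sigma.mk.inj e
      obtain ⟨h2, e'⟩ := Sigma.mk.inj e'
      dsimp only at h1 h2
      subst h1 h2
      have : i = j := le_antisymm (oCompK_le A _ _ h) (oCompK_le A _ _ h')
      subst this
      rw [oCompK_same] at h h'
      exact (hc i).2 u v x y h h' (eq_of_heq e) (eq_of_heq e')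
  · classical
    obtain ⟨c, hc1, hc2⟩ := ocn_attained (oCompK A)
      (by
        rintro ⟨i, u⟩ h
        exact hirr i u ((oCompK_same A i u u).1 h))
      (by
        rintro ⟨i, u⟩ ⟨j, v⟩ h h'
        have : i = j := le_antisymm (oCompK_le A _ _ h) (oCompK_le A _ _ h')
        subst this
        rw [oCompK_same] at h h'
        exact hor i u v h h')
    let S : Fin k → Finset (Fin (orientedChromaticNumber (oCompK A))) :=
      fun i => Finset.univ.image fun v : V i => c ⟨i, v⟩
    have hS : ∀ i, orientedChromaticNumber (A i) ≤ (S i).card := by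
      intro i
      have key := ocn_le_card (C := S i) (A i)
        (fun v => ⟨c ⟨i, v⟩, Finset.mem_image_of_mem _ (Finset.mem_univ v)⟩) ?_ ?_
      · simpa using key
      · intro u v h e
        exact hc1 _ _ ((oCompK_same A i u v).2 h) (Subtype.mk.inj e)
      · intro u v x y h h' e e'
        exact hc2 _ _ _ _ ((oCompK_same A i u v).2 h) ((oCompK_same A i x y).2 h')
          (Subtype.mk.inj e) (Subtype.mk.inj e')
    have hd : ∀ i ∈ (Finset.univ : Finset (Fin k)), ∀ j ∈ (Finset.univ : Finset (Fin k)),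
        i ≠ j → Disjoint (S i) (S j) := by
      intro i _ j _ hij
      rw [Finset.disjoint_left]
      intro a ha hb
      obtain ⟨u, -, hu⟩ := Finset.mem_image.1 ha
      obtain ⟨v, -, hv⟩ := Finset.mem_image.1 hb
      rcases lt_or_gt_of_ne hij with h | h
      · exact hc1 ⟨i, u⟩ ⟨j, v⟩ (Or.inr h) (hu.trans hv.symm)
      · exact hc1 ⟨j, v⟩ ⟨i, u⟩ (Or.inr h) (hv.trans hu.symm)
    calc ∑ i, orientedChromaticNumber (A i) ≤ ∑ i, (S i).card :=
          Finset.sum_le_sum fun i _ => hS i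
      _ = (Finset.univ.biUnion S).card := (Finset.card_biUnion hd).symm
      _ ≤ Fintype.card (Fin (orientedChromaticNumber (oCompK A))) := Finset.card_le_univ _
      _ = _ := Fintype.card_fin _
end

section
/- Let G1,…,Gk be k vertex-disjoint finite nonempty oriented co-graphs. Then χ_o(G1 ⊕ … ⊕ Gk) = max(χ_o(G1),…,χ_o(Gk)). -/
theorem oc_level {V : Type} (A : V → V → Prop) (hirr : Irreflexive A) {S : Set V}
    (h : IsOCOn A S) : ∃ (f : V → ℕ) (l : List V), (∀ v ∈ S, f v < l.length) ∧
      (∀ u ∈ S, ∀ v ∈ S, A u v → f u < f v) ∧ l.Pairwise A ∧ ∀ v ∈ l, v ∈ S := by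
  classical
  induction h with
  | single v =>
    refine ⟨fun _ => 0, [v], by simp, ?_, by simp, by simp⟩
    rintro u rfl w rfl h
    exact absurd h (hirr _)
  | union S T hd hS hT harc ihS ihT =>
    obtain ⟨f, l, hf, hm, hl, hlS⟩ := ihS
    obtain ⟨g, m, hg, hn, hk, hkT⟩ := ihT
    have hTS : ∀ v ∈ T, v ∉ S := fun v hv hs => Set.disjoint_left.1 hd hs hv
    have hmono : ∀ u ∈ S ∪ T, ∀ v ∈ S ∪ T, A u v →
        (if u ∈ S then f u else g u) < (if v ∈ S then f v else g v) := by
      rintro u (hu | hu) v (hv | hv) huv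
      · simpa [hu, hv] using hm u hu v hv huv
      · exact absurd huv (harc u hu v hv).1
      · exact absurd huv (harc v hv u hu).2
      · simpa [hTS u hu, hTS v hv] using hn u hu v hv huv
    rcases le_total l.length m.length with hle | hle
    · refine ⟨_, m, ?_, hmono, hk, fun v hv => Or.inr (hkT v hv)⟩
      rintro v (hv | hv)
      · simpa [hv] using (hf v hv).trans_le hle
      · simpa [hTS v hv] using hg v hv
    · refine ⟨_, l, ?_, hmono, hl, fun v hv => Or.inl (hlS v hv)⟩
      rintro v (hv | hv)
      · simpa [hv] using hf v hv
      · simpa [hTS v hv] using (hg v hv).trans_le hle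
  | order S T hd hS hT harc ihS ihT =>
    obtain ⟨f, l, hf, hm, hl, hlS⟩ := ihS
    obtain ⟨g, m, hg, hn, hk, hkT⟩ := ihT
    have hTS : ∀ v ∈ T, v ∉ S := fun v hv hs => Set.disjoint_left.1 hd hs hv
    refine ⟨fun v => if v ∈ S then f v else l.length + g v, l ++ m, ?_, ?_, ?_, ?_⟩
    · rintro v (hv | hv)
      · have := hf v hv
        simp [hv]; omega
      · have := hg v hv
        simp [hTS v hv]; omega
    · rintro u (hu | hu) v (hv | hv) huv
      · simpa [hu, hv] using hm u hu v hv huv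
      · have := hf u hu
        simp [hu, hTS v hv]; omega
      · exact absurd huv (harc v hv u hu).2
      · simpa [hTS u hu, hTS v hv] using hn u hu v hv huv
    · rw [List.pairwise_append]
      exact ⟨hl, hk, fun a ha b hb => (harc a (hlS a ha) b (hkT b hb)).1⟩
    · intro v hv
      rcases List.mem_append.1 hv with hv | hv
      · exact Or.inl (hlS v hv)
      · exact Or.inr (hkT v hv)

theorem coloring_of_level {V : Type} (A : V → V → Prop) (k : ℕ) (f : V → Fin k)
    (h : ∀ u v, A u v → f u < f v) : IsOrientedColoring A k f := by
  refine ⟨fun u v huv => (h u v huv).ne, fun u v x y huv hxy e => ?_⟩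
  have h1 := h u v huv
  have h2 := h x y hxy
  rw [e] at h1
  exact (h1.trans h2).ne

theorem oc_exists {V : Type} (A : V → V → Prop) (hirr : Irreflexive A)
    (h : IsOrientedCograph A) : ∃ f : V → ℕ, (∀ v, f v < orientedChromaticNumber A) ∧
      ∀ u v, A u v → f u < f v := by
  obtain ⟨f, l, hf, hm, hl, -⟩ := oc_level A hirr h
  refine ⟨f, fun v => (hf v trivial).trans_le ?_, fun u v => hm u trivial v trivial⟩
  refine le_csInf ⟨l.length, fun v => ⟨f v, hf v trivial⟩, ?_⟩ ?_
  · exact coloring_of_level A _ _ fun u v huv => hm u trivial v trivial huv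
  · rintro k ⟨c, hc⟩
    have hnd : (l.map c).Nodup := by
      rw [List.Nodup, List.pairwise_map]
      exact hl.imp fun {a b} hab => hc.1 a b hab
    simpa using hnd.length_le_card

/-- The oriented chromatic number of a disjoint union of
finitely many finite nonempty oriented co-graphs equals the maximum of the
oriented chromatic numbers of the parts. -/
theorem stmt_10 {k : ℕ} {V : Fin k → Type} [∀ i, Fintype (V i)]
    [∀ i, Nonempty (V i)]
    (A : ∀ i, V i → V i → Prop)
    (hirr : ∀ i, Irreflexive (A i))
    (hoc : ∀ i, IsOrientedCograph (A i)) :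
    orientedChromaticNumber (dUnionK A) =
      Finset.univ.sup (fun i => orientedChromaticNumber (A i)) := by
  choose f hf hm using fun i => oc_exists (A i) (hirr i) (hoc i)
  have hcol : ∃ c : (Σ i, V i) →
      Fin (Finset.univ.sup (fun i => orientedChromaticNumber (A i))),
      IsOrientedColoring (dUnionK A) _ c := by
    refine ⟨fun v => ⟨f v.1 v.2, (hf v.1 v.2).trans_le
      (Finset.le_sup (f := fun i => orientedChromaticNumber (A i)) (Finset.mem_univ v.1))⟩,
      coloring_of_level _ _ _ ?_⟩
    rintro ⟨i, u⟩ ⟨j, v⟩ ⟨h, huv⟩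
    dsimp only at h
    subst h
    exact hm i u v huv
  apply le_antisymm
  · exact Nat.sInf_le hcol
  · refine Finset.sup_le fun i _ => ?_
    refine le_csInf ⟨_, hcol⟩ ?_
    rintro n ⟨c, hc⟩
    refine Nat.sInf_le ⟨fun v => c ⟨i, v⟩, fun u v huv => hc.1 _ _ ⟨rfl, huv⟩,
      fun u v x y huv hxy => hc.2 _ _ _ _ ⟨rfl, huv⟩ ⟨rfl, hxy⟩⟩
end

section
/- Let G be a finite nonempty oriented co-graph on n vertices. Then χ_o(G) = n (i.e. G is an oriented clique) if and only if G is a transitive tournament. -/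
/-- Arcs are transitive within an oriented co-graph. -/
theorem oc_trans {V : Type} (A : V → V → Prop) (S : Set V) (h : IsOCOn A S) :
    ∀ u ∈ S, ∀ v ∈ S, ∀ w ∈ S, A u v → A v w → A u w := by
  induction h with
  | single v => 
    rintro u rfl v rfl w rfl h _
    exact h
  | union S T hd hS hT harc ihS ihT =>
    rintro u (hu | hu) v (hv | hv) w (hw | hw) h1 h2 <;> grind
  | order S T hd hS hT harc ihS ihT =>
    rintro u (hu | hu) v (hv | hv) w (hw | hw) h1 h2 <;> grind

theorem merge_coloring {V : Type} [Fintype V] (A : V → V → Prop)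
    (hirr : ∀ v, ¬ A v v) (ht : ∀ u v w, A u v → A v w → A u w)
    (f : V → V) (u v : V) (hf : ∀ x y, f x = f y → x = y ∨ (x = u ∧ y = v) ∨ (x = v ∧ y = u))
    (h1 : ¬ A u v) (h2 : ¬ A v u) (k : ℕ) (g : V → Fin k) (hg : ∀ x y, g (f x) = g (f y) → f x = f y) :
    IsOrientedColoring A k (g ∘ f) := by
  constructor
  · intro x y hxy he
    have := hf x y (hg x y he)
    grind
  · intro a b x y hab hxy he1 he2
    have e1 := hf b x (hg _ _ he1)
    have e2 := hf a y (hg _ _ he2)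
    have t1 := ht a b y hab
    have t2 := ht x y b hxy
    grind

/-- A finite nonempty oriented co-graph on `n` vertices has
oriented chromatic number `n` (i.e. it is an oriented clique) iff it is a
transitive tournament. -/
theorem stmt_11 {V : Type} [Fintype V] [Nonempty V] (A : V → V → Prop)
    (hirr : Irreflexive A) (hoc : IsOrientedCograph A) :
    orientedChromaticNumber A = Fintype.card V ↔
      ((∀ u v : V, u ≠ v → Xor' (A u v) (A v u)) ∧
        ∀ u v w : V, A u v → A v w → A u w) := by
  have hi : ∀ v, ¬ A v v := fun v => hirr v
  have ht : ∀ u v w, A u v → A v w → A u w := fun u v w =>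
    oc_trans A _ hoc u trivial v trivial w trivial
  have hid : Fintype.card V ∈ {k : ℕ | ∃ c : V → Fin k, IsOrientedColoring A k c} := by
    obtain ⟨w⟩ := ‹Nonempty V›
    exact ⟨_, merge_coloring A hi ht id w w (fun x y h => Or.inl h) (hi w) (hi w) _
      (Fintype.equivFin V) (fun x y h => (Fintype.equivFin V).injective h)⟩
  constructor
  · intro h
    refine ⟨fun u v huv => ?_, ht⟩
    by_contra hx
    have hn : ¬ A u v ∧ ¬ A v u := by
      have := ht u v u
      have := hi u
      unfold Xor' Xor at hx
      tauto
    classical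
    have hcard : Fintype.card {x : V // x ≠ v} < Fintype.card V :=
      Fintype.card_subtype_lt (x := v) (by simp)
    let e := Fintype.equivFin {x : V // x ≠ v}
    let g : V → Fin (Fintype.card {x : V // x ≠ v}) := fun x =>
      if hx : x ≠ v then e ⟨x, hx⟩ else e ⟨u, huv⟩
    let f : V → V := fun x => if x = v then u else x
    have hfv : ∀ x, f x ≠ v := by
      intro x
      simp only [f]
      split_ifs <;> assumption
    have hc := merge_coloring A hi ht f u v (by
      intro x y hxy
      simp only [f] at hxy
      grind) hn.1 hn.2 _ g (by
      intro x y hxy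
      simp only [g, dif_pos (hfv x), dif_pos (hfv y)] at hxy
      simpa using e.injective hxy)
    have : orientedChromaticNumber A ≤ _ := Nat.sInf_le ⟨_, hc⟩
    omega
  · rintro ⟨hx, -⟩
    refine le_antisymm (Nat.sInf_le hid) (le_csInf ⟨_, hid⟩ ?_)
    rintro k ⟨c, hc, -⟩
    have : Function.Injective c := by
      intro a b hab
      by_contra hne
      rcases hx a b hne with h | h
      · exact hc _ _ h.1 hab
      · exact hc _ _ h.1 hab.symm
    simpa using Fintype.card_le_of_injective c this
end

section
/- Let G be a finite oriented co-graph and k a positive integer. There is an oriented k-coloring of G if and only if there is a homomorphism from G to the transitive tournament →T_k on k vertices. -/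
theorem oc_aux {V : Type} [Fintype V] (A : V → V → Prop)
    (hirr : Irreflexive A) (k : ℕ) (c : V → Fin k)
    (hc : ∀ u v : V, A u v → c u ≠ c v) (S : Set V) (hS : IsOCOn A S) :
    ∃ h : V → ℕ, (∀ u ∈ S, ∀ v ∈ S, A u v → h u < h v) ∧ ∀ v ∈ S, h v < (c '' S).ncard := by
  classical
  induction hS with
  | single w =>
    refine ⟨fun _ => 0, ?_, ?_⟩
    · rintro u rfl v rfl huv
      exact absurd huv (hirr _)
    · intro v _
      simp
  | union S T hd _ _ harc ihS ihT =>
    obtain ⟨f, hf, hf'⟩ := ihS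
    obtain ⟨g, hg, hg'⟩ := ihT
    have h1 : (c '' S).ncard ≤ (c '' (S ∪ T)).ncard :=
      Set.ncard_le_ncard (Set.image_mono Set.subset_union_left) (Set.toFinite _)
    have h2 : (c '' T).ncard ≤ (c '' (S ∪ T)).ncard :=
      Set.ncard_le_ncard (Set.image_mono Set.subset_union_right) (Set.toFinite _)
    have hST : ∀ v ∈ T, v ∉ S := fun v hT hS => Set.disjoint_left.mp hd hS hT
    refine ⟨fun v => if v ∈ S then f v else g v, ?_, ?_⟩
    · rintro u (hu | hu) v (hv | hv) huv
      · simpa [hu, hv] using hf u hu v hv huv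
      · exact absurd huv (harc u hu v hv).1
      · exact absurd huv (harc v hv u hu).2
      · simpa [hST u hu, hST v hv] using hg u hu v hv huv
    · rintro v (hv | hv)
      · simpa [hv] using (hf' v hv).trans_le h1
      · simpa [hST v hv] using (hg' v hv).trans_le h2
  | order S T hd _ _ harc ihS ihT =>
    obtain ⟨f, hf, hf'⟩ := ihS
    obtain ⟨g, hg, hg'⟩ := ihT
    have hdis : Disjoint (c '' S) (c '' T) := by
      rw [Set.disjoint_left]
      rintro _ ⟨u, hu, rfl⟩ ⟨v, hv, hvu⟩
      exact hc u v (harc u hu v hv).1 hvu.symm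
    have h1 : (c '' (S ∪ T)).ncard = (c '' S).ncard + (c '' T).ncard := by
      rw [Set.image_union, Set.ncard_union_eq hdis (Set.toFinite _) (Set.toFinite _)]
    have hST : ∀ v ∈ T, v ∉ S := fun v hT hS => Set.disjoint_left.mp hd hS hT
    refine ⟨fun v => if v ∈ S then f v else (c '' S).ncard + g v, ?_, ?_⟩
    · rintro u (hu | hu) v (hv | hv) huv
      · simpa [hu, hv] using hf u hu v hv huv
      · have := hf' u hu
        simp only [hu, hST v hv, if_true, if_false]
        omega
      · exact absurd huv (harc v hv u hu).2
      · simpa [hST u hu, hST v hv] using hg u hu v hv huv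
    · rw [h1]
      rintro v (hv | hv)
      · have := hf' v hv
        simp only [hv, if_true]
        omega
      · have := hg' v hv
        simp only [hST v hv, if_false]
        omega

/-- A finite oriented co-graph admits an oriented `k`-coloring
iff it has a homomorphism to the transitive tournament on `k` vertices. -/
theorem stmt_12 {V : Type} [Fintype V] (A : V → V → Prop)
    (hirr : Irreflexive A) (hoc : IsOrientedCograph A)
    (k : ℕ) (hk : 0 < k) :
    (∃ c : V → Fin k, IsOrientedColoring A k c) ↔
      ∃ h : V → Fin k, IsDiHom A (ttArcs k) h := by
  constructor
  · rintro ⟨c, hc, -⟩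
    obtain ⟨h, hh, hlt⟩ := oc_aux A hirr k c hc Set.univ hoc
    have hle : (c '' Set.univ).ncard ≤ k := by
      have := Set.ncard_le_card (c '' Set.univ)
      simpa using this
    refine ⟨fun v => ⟨h v, (hlt v trivial).trans_le hle⟩, ?_⟩
    intro u v huv
    exact hh u trivial v trivial huv
  · rintro ⟨h, hh⟩
    have hh' : ∀ u v, A u v → h u < h v := hh
    refine ⟨h, fun u v huv => (hh' u v huv).ne, ?_⟩
    intro u v x y huv hxy hvx huy
    have h1 := hh' u v huv
    have h2 := hh' x y hxy
    rw [hvx, huy] at h1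
    exact lt_asymm h1 h2
end

section
/- A finite directed graph G admits a homomorphism to the transitive tournament →T_k on k vertices if and only if there is no homomorphism from the oriented path →P_{k+1} on k+1 vertices to G. -/
/-- There is a walk with `n` arcs ending at `v`. -/
def WalkTo {V : Type} (A : V → V → Prop) (n : ℕ) (v : V) : Prop :=
  ∃ f : ℕ → V, (∀ i < n, A (f i) (f (i + 1))) ∧ f n = v

theorem WalkTo.step {V : Type} {A : V → V → Prop} {n : ℕ} {u v : V}
    (h : WalkTo A n u) (huv : A u v) : WalkTo A (n + 1) v := by
  obtain ⟨f, hf, hn⟩ := h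
  refine ⟨fun i => if i ≤ n then f i else v, ?_, by simp⟩
  intro i hi
  rcases Nat.lt_succ_iff_lt_or_eq.mp hi with h | h
  · have h1 : i ≤ n := h.le
    have h2 : i + 1 ≤ n := h
    simpa [h1, h2] using hf i h
  · subst h
    simpa [hn] using huv

/-- A finite digraph has a homomorphism to the transitive
tournament on `k` vertices iff there is no homomorphism from the oriented
path on `k+1` vertices to it. -/
theorem stmt_13 {V : Type} [Fintype V] (A : V → V → Prop)
    (hirr : Irreflexive A) (k : ℕ) :
    (∃ h : V → Fin k, IsDiHom A (ttArcs k) h) ↔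
      ¬ ∃ f : Fin (k + 1) → V, IsDiHom (pathArcs (k + 1)) A f := by
  classical
  constructor
  · rintro ⟨h, hh⟩ ⟨f, hf⟩
    have key : ∀ i : ℕ, ∀ hi : i < k + 1, i ≤ (h (f ⟨i, hi⟩) : ℕ) := by
      intro i
      induction i with
      | zero => intro _; exact Nat.zero_le _
      | succ i ih =>
        intro hi
        have h1 := ih (by omega)
        have h2 : h (f ⟨i, by omega⟩) < h (f ⟨i + 1, hi⟩) := hh _ _ (hf _ _ rfl)
        have h3 : (h (f ⟨i, by omega⟩) : ℕ) < h (f ⟨i + 1, hi⟩) := h2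
        omega
    have h1 := key k (by omega)
    have h2 := (h (f ⟨k, by omega⟩)).isLt
    omega
  · intro hno
    have hk : ∀ v, ¬ WalkTo A k v := by
      rintro v ⟨f, hf, -⟩
      refine hno ⟨fun i => f i, ?_⟩
      intro i j hij
      have hij' : (i : ℕ) + 1 = j := hij
      have := hf i (by omega)
      rwa [hij'] at this
    have hw : ∀ v, WalkTo A (Nat.findGreatest (fun n => WalkTo A n v) k) v := by
      intro v
      exact Nat.findGreatest_spec (P := fun n => WalkTo A n v) (Nat.zero_le k)
        ⟨fun _ => v, by simp, rfl⟩
    have hlt : ∀ v, Nat.findGreatest (fun n => WalkTo A n v) k < k := by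
      intro v
      refine lt_of_le_of_ne (Nat.findGreatest_le k) ?_
      intro h
      have := hw v
      rw [h] at this
      exact hk v this
    refine ⟨fun v => ⟨_, hlt v⟩, ?_⟩
    intro u v huv
    exact Nat.le_findGreatest (P := fun n => WalkTo A n v) (hlt u) ((hw u).step huv)
end

section
/- Let G be a finite nonempty oriented co-graph. Then the oriented chromatic number χ_o(G) equals the minimum k such that there is no homomorphism from the oriented path →P_{k+1} on k+1 vertices to G. -/
theorem cograph_key {V : Type} (A : V → V → Prop) (hirr : ∀ v, ¬ A v v) (S : Set V)
    (h : IsOCOn A S) : ∃ (m : ℕ) (c : V → ℕ) (f : ℕ → V),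
      (∀ v ∈ S, c v < m) ∧ (∀ u ∈ S, ∀ v ∈ S, A u v → c u < c v) ∧
      (∀ i < m, f i ∈ S) ∧ (∀ i j, i < j → j < m → A (f i) (f j)) := by
  classical
  induction h with
  | single v =>
    refine ⟨1, fun _ => 0, fun _ => v, by simp, ?_, by simp, by intros; omega⟩
    intro u hu w hw ha
    simp only [Set.mem_singleton_iff] at hu hw
    subst hu
    subst hw
    exact absurd ha (hirr _)
  | union S T hd hS hT harc ihS ihT =>
    obtain ⟨m, c, f, h1, h2, h3, h4⟩ := ihS
    obtain ⟨n, d, g, k1, k2, k3, k4⟩ := ihT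
    have hdis : ∀ v ∈ T, v ∉ S := fun v hv hv' => Set.disjoint_left.mp hd hv' hv
    have e1 : ∀ v ∈ S ∪ T, (if v ∈ S then c v else d v) < max m n := by
      rintro v (hv | hv)
      · simp [hv, h1 v hv]
      · simp [hdis v hv, k1 v hv]
    have e2 : ∀ u ∈ S ∪ T, ∀ v ∈ S ∪ T, A u v →
        (if u ∈ S then c u else d u) < (if v ∈ S then c v else d v) := by
      rintro u (hu | hu) v (hv | hv) ha
      · simpa [hu, hv] using h2 u hu v hv ha
      · exact absurd ha (harc u hu v hv).1
      · exact absurd ha (harc v hv u hu).2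
      · simpa [hdis u hu, hdis v hv] using k2 u hu v hv ha
    rcases le_total n m with hmn | hmn
    · rw [max_eq_left hmn] at e1
      exact ⟨m, _, f, e1, e2, fun i hi => Or.inl (h3 i hi), h4⟩
    · rw [max_eq_right hmn] at e1
      exact ⟨n, _, g, e1, e2, fun i hi => Or.inr (k3 i hi), k4⟩
  | order S T hd hS hT harc ihS ihT =>
    obtain ⟨m, c, f, h1, h2, h3, h4⟩ := ihS
    obtain ⟨n, d, g, k1, k2, k3, k4⟩ := ihT
    have hdis : ∀ v ∈ T, v ∉ S := fun v hv hv' => Set.disjoint_left.mp hd hv' hv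
    refine ⟨m + n, fun v => if v ∈ S then c v else m + d v,
      fun i => if i < m then f i else g (i - m), ?_, ?_, ?_, ?_⟩
    · rintro v (hv | hv)
      · have := h1 v hv
        simp only [hv, if_true]
        omega
      · simp [hdis v hv, k1 v hv]
    · rintro u (hu | hu) v (hv | hv) ha
      · simpa [hu, hv] using h2 u hu v hv ha
      · have := h1 u hu
        simp only [hu, hdis v hv, if_true, if_false]
        omega
      · exact absurd ha (harc v hv u hu).2
      · simpa [hdis u hu, hdis v hv] using k2 u hu v hv ha
    · intro i hi
      by_cases him : i < m
      · simp only [him, if_true]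
        exact Or.inl (h3 i him)
      · simp only [him, if_false]
        exact Or.inr (k3 _ (by omega))
    · intro i j hij hj
      by_cases hjm : j < m
      · have him : i < m := by omega
        simp only [him, hjm, if_true]
        exact h4 i j hij hjm
      · by_cases him : i < m
        · simp only [him, hjm, if_true, if_false]
          exact (harc _ (h3 i him) _ (k3 _ (by omega))).1
        · simp only [him, hjm, if_false]
          exact k4 _ _ (by omega) (by omega)

/-- The oriented chromatic number of a finite nonempty
oriented co-graph equals the minimum `k` such that there is no homomorphism
from the oriented path on `k+1` vertices to it. -/
theorem stmt_14 {V : Type} [Fintype V] [Nonempty V] (A : V → V → Prop)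
    (hirr : Irreflexive A) (hoc : IsOrientedCograph A) :
    orientedChromaticNumber A =
      sInf {k : ℕ | ¬ ∃ f : Fin (k + 1) → V, IsDiHom (pathArcs (k + 1)) A f} := by
  obtain ⟨m, c, f, h1, h2, h3, h4⟩ := cograph_key A (fun v => hirr v) _ hoc
  have h1' : ∀ v, c v < m := fun v => h1 v trivial
  have h2' : ∀ u v, A u v → c u < c v := fun u v => h2 u trivial v trivial
  have hchi : IsLeast {k : ℕ | ∃ c : V → Fin k, IsOrientedColoring A k c} m := by
    constructor
    · refine ⟨fun v => ⟨c v, h1' v⟩, ?_, ?_⟩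
      · intro u v ha he
        have := h2' u v ha
        simp only [Fin.mk.injEq] at he
        omega
      · intro u v x y ha hb he he'
        have := h2' u v ha
        have := h2' x y hb
        simp only [Fin.mk.injEq] at he he'
        omega
    · rintro k ⟨d, hd, -⟩
      have hinj : Function.Injective (fun i : Fin m => d (f i)) := by
        intro i j hij
        rcases lt_trichotomy i j with hlt | heq | hlt
        · exact absurd hij (hd _ _ (h4 _ _ hlt j.2))
        · exact heq
        · exact absurd hij.symm (hd _ _ (h4 _ _ hlt i.2))
      simpa using Fintype.card_le_of_injective _ hinj
  have hpath : IsLeast {k : ℕ | ¬ ∃ f : Fin (k + 1) → V, IsDiHom (pathArcs (k + 1)) A f} m := by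
    constructor
    · rintro ⟨p, hp⟩
      have hle : ∀ i (hi : i < m + 1), i ≤ c (p ⟨i, hi⟩) := by
        intro i
        induction i with
        | zero => intro _; omega
        | succ i ih =>
          intro hi
          have a := ih (by omega)
          have b := h2' _ _ (hp ⟨i, by omega⟩ ⟨i + 1, hi⟩ rfl)
          omega
      have a := hle m (by omega)
      have b := h1' (p ⟨m, by omega⟩)
      omega
    · intro k hk
      by_contra hlt
      apply hk
      refine ⟨fun i => f i, ?_⟩
      intro i j hij
      have hij' : (i : ℕ) + 1 = j := hij
      exact h4 _ _ (by omega) (by omega)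
  unfold orientedChromaticNumber
  rw [hchi.csInf_eq, hpath.csInf_eq]
end

section
/- Let G be a finite nonempty oriented co-graph. Then ℓ(G) = χ_o(G) − 1, i.e. the length of a longest oriented path in G equals the oriented chromatic number of G minus one. -/
theorem oc_cert {V : Type} (A : V → V → Prop) (hirr : Irreflexive A) (S : Set V)
    (h : IsOCOn A S) : ∃ (k : ℕ) (c : V → ℕ) (l : List V), 0 < k ∧ (∀ v ∈ S, c v < k) ∧
      (∀ u ∈ S, ∀ v ∈ S, A u v → c u < c v) ∧ (∀ v ∈ l, v ∈ S) ∧ l.Pairwise A ∧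
      l.length = k := by
  classical
  induction h with
  | single v =>
    refine ⟨1, fun _ => 0, [v], by simp, by simp, ?_, by simp, by simp, by simp⟩
    intro u hu w hw h
    rw [Set.mem_singleton_iff] at hu hw
    subst hu; subst hw
    exact absurd h (hirr _)
  | union S T hd hS hT harc ihS ihT =>
    obtain ⟨k, c, l, hk, h1, h2, h3, h4, h5⟩ := ihS
    obtain ⟨k', c', l', hk', h1', h2', h3', h4', h5'⟩ := ihT
    rw [Set.disjoint_left] at hd
    have key : ∀ u ∈ S ∪ T, ∀ v ∈ S ∪ T, A u v →
        (if u ∈ S then c u else c' u) < (if v ∈ S then c v else c' v) := by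
      intro u hu v hv h
      rcases hu with hu | hu <;> rcases hv with hv | hv
      · simpa [hu, hv] using h2 u hu v hv h
      · exact absurd h (harc u hu v hv).1
      · exact absurd h (harc v hv u hu).2
      · have a : u ∉ S := fun a => hd a hu
        have b : v ∉ S := fun a => hd a hv
        simpa [a, b] using h2' u hu v hv h
    have bd : ∀ v ∈ S ∪ T, (if v ∈ S then c v else c' v) < max k k' := by
      intro v hv
      by_cases hvS : v ∈ S
      · have := h1 v hvS
        simp [hvS, this]
      · have := h1' v (hv.resolve_left hvS)
        simp [hvS, this]
    rcases le_total k k' with hkk | hkk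
    · exact ⟨max k k', _, l', by omega, bd, key, fun v hv => Or.inr (h3' v hv), h4', by omega⟩
    · exact ⟨max k k', _, l, by omega, bd, key, fun v hv => Or.inl (h3 v hv), h4, by omega⟩
  | order S T hd hS hT harc ihS ihT =>
    obtain ⟨k, c, l, hk, h1, h2, h3, h4, h5⟩ := ihS
    obtain ⟨k', c', l', hk', h1', h2', h3', h4', h5'⟩ := ihT
    rw [Set.disjoint_left] at hd
    refine ⟨k + k', fun v => if v ∈ S then c v else k + c' v, l ++ l', by omega, ?_, ?_, ?_, ?_,
      by simp [h5, h5']⟩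
    · intro v hv
      by_cases hvS : v ∈ S
      · have := h1 v hvS
        simp only [hvS, if_true]; omega
      · have := h1' v (hv.resolve_left hvS)
        simp only [hvS, if_false]; omega
    · intro u hu v hv h
      rcases hu with hu | hu <;> rcases hv with hv | hv
      · simpa [hu, hv] using h2 u hu v hv h
      · have b : v ∉ S := fun a => hd a hv
        have := h1 u hu
        simp only [hu, b, if_true, if_false]; omega
      · exact absurd h (harc v hv u hu).2
      · have a : u ∉ S := fun a => hd a hu
        have b : v ∉ S := fun a => hd a hv
        simpa [a, b] using h2' u hu v hv h
    · intro v hv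
      rcases List.mem_append.1 hv with hv | hv
      · exact Or.inl (h3 v hv)
      · exact Or.inr (h3' v hv)
    · exact List.pairwise_append.2 ⟨h4, h4', fun a ha b hb => (harc a (h3 a ha) b (h3' b hb)).1⟩

theorem stmt_17 {V : Type} [Fintype V] [Nonempty V] (A : V → V → Prop)
    (hirr : Irreflexive A) (hoc : IsOrientedCograph A) :
    longestOrientedPath A = orientedChromaticNumber A - 1 := by
  obtain ⟨k, c, l, hk, h1, h2, -, h4, h5⟩ := oc_cert A hirr _ hoc
  have hc : ∀ u v, A u v → c u < c v := fun u v => h2 u trivial v trivial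
  have hnod : l.Nodup := h4.imp (fun {a b} h e => by subst e; exact hirr _ h)
  have hchi : orientedChromaticNumber A = k := by
    apply le_antisymm
    · apply Nat.sInf_le
      refine ⟨fun v => ⟨c v, h1 v trivial⟩, ?_, ?_⟩
      · intro u v h e
        have := hc u v h
        have := congrArg Fin.val e
        simp at this; omega
      · intro u v x y h h' e e'
        have := hc u v h
        have := hc x y h'
        have := congrArg Fin.val e
        have := congrArg Fin.val e'
        simp at *; omega
    · apply le_csInf
      · refine ⟨k, fun v => ⟨c v, h1 v trivial⟩, ?_, ?_⟩
        · intro u v h e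
          have := hc u v h
          have := congrArg Fin.val e
          simp at this; omega
        · intro u v x y h h' e e'
          have := hc u v h
          have := hc x y h'
          have := congrArg Fin.val e
          have := congrArg Fin.val e'
          simp at *; omega
      · rintro m ⟨f, hf, -⟩
        have hn : (l.map f).Nodup := List.pairwise_map.2 (h4.imp (fun {a b} h => hf a b h))
        have := hn.length_le_card
        simpa [h5] using this
  have hl : IsGreatest {n : ℕ | ∃ l : List V, l.Chain' A ∧ l.Nodup ∧ l.length = n + 1} (k - 1) := by
    constructor
    · exact ⟨l, h4.isChain, hnod, by omega⟩
    · rintro n ⟨p, hp, -, hpl⟩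
      have hq : (p.map c).IsChain (· < ·) := (List.isChain_map c).2 (hp.imp (fun a b h => hc a b h))
      have hn : (p.map c).Nodup := hq.pairwise.imp (fun {a b} h => Nat.ne_of_lt h)
      have hsub : (p.map c).toFinset ⊆ Finset.range k := by
        intro x hx
        simp only [List.mem_toFinset, List.mem_map] at hx
        obtain ⟨v, -, rfl⟩ := hx
        exact Finset.mem_range.2 (h1 v trivial)
      have := Finset.card_le_card hsub
      rw [List.toFinset_card_of_nodup hn] at this
      simp at this
      omega
  rw [hchi]
  exact hl.csSup_eq
end
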